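/- arXiv:1304.5465 — 7 statements merged into one kernel-verified Lean document; each statement's English description precedes it below -/
import Mathlib

section
/- The map sending (h₁,h₂) ∈ ℕ × ℤ to (max(h₁+h₂, -h₁-h₂-1), max(h₁-h₂, h₂-h₁-1)) restricts, for every natural number n, to a bijection from the set {(h₁,h₂) ∈ ℕ × ℤ : h₁(h₁+1) + h₂² = n} onto the set {(m₁,m₂) ∈ ℕ × ℕ : m₁(m₁+1)/2 + m₂(m₂+1)/2 = n}. -/
/-- The Waldspurger map `W : ℕ × ℤ → ℕ × ℕ` sending `(h₁, h₂)` to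
`(max (h₁+h₂) (-h₁-h₂-1), max (h₁-h₂) (h₂-h₁-1))`, the maxima taken in `ℤ`
(both coordinates are always nonnegative). -/
def waldspurger (h : ℕ × ℤ) : ℕ × ℕ :=
  ((max ((h.1 : ℤ) + h.2) (-(h.1 : ℤ) - h.2 - 1)).toNat,
   (max ((h.1 : ℤ) - h.2) (h.2 - (h.1 : ℤ) - 1)).toNat)

/-- For every `n`, the Waldspurger map restricts to a bijection from
`{(h₁,h₂) ∈ ℕ × ℤ : h₁(h₁+1) + h₂² = n}` onto
`{(m₁,m₂) ∈ ℕ × ℕ : m₁(m₁+1)/2 + m₂(m₂+1)/2 = n}`. -/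
theorem waldspurger_bijOn (n : ℕ) :
    Set.BijOn waldspurger
      {p : ℕ × ℤ | (p.1 : ℤ) * (p.1 + 1) + p.2 ^ 2 = (n : ℤ)}
      {q : ℕ × ℕ | q.1 * (q.1 + 1) + q.2 * (q.2 + 1) = 2 * n} := by
  refine ⟨?_, ?_, ?_⟩
  · rintro ⟨a, b⟩ h
    simp only [Set.mem_setOf_eq] at h ⊢
    have key : ∀ x : ℤ, ((max x (-x - 1)).toNat : ℤ) * (((max x (-x - 1)).toNat : ℤ) + 1)
        = x * (x + 1) := by
      intro x
      have h1 : ((max x (-x - 1)).toNat : ℤ) = x ∨ ((max x (-x - 1)).toNat : ℤ) = -x - 1 := by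
        omega
      rcases h1 with h1 | h1 <;> rw [h1] <;> ring
    have k1 := key ((a : ℤ) + b)
    have k2 := key ((a : ℤ) - b)
    rw [show -((a : ℤ) + b) - 1 = -(a : ℤ) - b - 1 by ring] at k1
    rw [show -((a : ℤ) - b) - 1 = b - (a : ℤ) - 1 by ring] at k2
    zify
    simp only [waldspurger]
    rw [k1, k2, ← h]
    ring
  · rintro ⟨a, b⟩ - ⟨c, d⟩ - h
    simp only [waldspurger, Prod.mk.injEq] at h ⊢
    omega
  · rintro ⟨x, y⟩ h
    simp only [Set.mem_setOf_eq] at h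
    zify at h
    simp only [Set.mem_image, Set.mem_setOf_eq, Prod.exists, waldspurger, Prod.mk.injEq]
    have h3 : ∃ (a : ℕ) (b : ℤ), ((x : ℤ) = a + b ∧ (y : ℤ) = a - b) ∨
        ((x : ℤ) = a + b ∧ (y : ℤ) = b - a - 1) ∨ ((x : ℤ) = -a - b - 1 ∧ (y : ℤ) = a - b) := by
      rcases Nat.even_or_odd' (x + y) with ⟨k, hk | hk⟩
      · exact ⟨k, x - k, by omega⟩
      · by_cases hxy : y < x
        · exact ⟨k - y, k + 1, by omega⟩
        · exact ⟨k - x, -k - 1, by omega⟩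
    obtain ⟨a, b, hab⟩ := h3
    refine ⟨a, b, ?_, by omega, by omega⟩
    rcases hab with ⟨h1, h2⟩ | ⟨h1, h2⟩ | ⟨h1, h2⟩ <;> rw [h1, h2] at h <;> linarith
end

section
/- For every pair (m₁,m₂) ∈ ℕ × ℕ there exist h₁ ∈ ℕ and h₂ ∈ ℤ with W(h₁,h₂) = (m₁,m₂), given explicitly as follows: if m₁ ≡ m₂ (mod 2) then h₁ = (m₁+m₂)/2 and h₂ = (m₁-m₂)/2; if m₁ ≢ m₂ (mod 2) and m₁ > m₂ then h₁ = (m₁-m₂-1)/2 and h₂ = (m₁+m₂+1)/2; if m₁ ≢ m₂ (mod 2) and m₁ < m₂ then h₁ = (m₂-m₁-1)/2 and h₂ = -(m₁+m₂+1)/2. -/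
/-- Every pair `(m₁,m₂) ∈ ℕ × ℕ` is in the image of the Waldspurger map, with
explicit preimages: if `m₁ ≡ m₂ (mod 2)` then `h₁ = (m₁+m₂)/2`, `h₂ = (m₁-m₂)/2`;
if `m₁ ≢ m₂ (mod 2)` and `m₁ > m₂` then `h₁ = (m₁-m₂-1)/2`, `h₂ = (m₁+m₂+1)/2`;
if `m₁ ≢ m₂ (mod 2)` and `m₁ < m₂` then `h₁ = (m₂-m₁-1)/2`, `h₂ = -(m₁+m₂+1)/2`.
(All displayed divisions by 2 are exact under the stated parity hypotheses.) -/
theorem waldspurger_surjective_explicit (m₁ m₂ : ℕ) :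
    (∃ h : ℕ × ℤ, waldspurger h = (m₁, m₂)) ∧
    (m₁ % 2 = m₂ % 2 →
      waldspurger ((m₁ + m₂) / 2, ((m₁ : ℤ) - (m₂ : ℤ)) / 2) = (m₁, m₂)) ∧
    (m₁ % 2 ≠ m₂ % 2 → m₂ < m₁ →
      waldspurger ((m₁ - m₂ - 1) / 2, ((m₁ : ℤ) + (m₂ : ℤ) + 1) / 2) = (m₁, m₂)) ∧
    (m₁ % 2 ≠ m₂ % 2 → m₁ < m₂ →
      waldspurger ((m₂ - m₁ - 1) / 2, -(((m₁ : ℤ) + (m₂ : ℤ) + 1) / 2)) = (m₁, m₂)) := by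
  have key : ∀ (a : ℕ) (b : ℤ),
      max ((a : ℤ) + b) (-(a : ℤ) - b - 1) = m₁ →
      max ((a : ℤ) - b) (b - (a : ℤ) - 1) = m₂ → waldspurger (a, b) = (m₁, m₂) := by
    intro a b h1 h2
    simp only [waldspurger, h1, h2, Int.toNat_natCast]
  have A : m₁ % 2 = m₂ % 2 →
      waldspurger ((m₁ + m₂) / 2, ((m₁ : ℤ) - (m₂ : ℤ)) / 2) = (m₁, m₂) := by
    intro h
    apply key <;> omega
  have B : m₁ % 2 ≠ m₂ % 2 → m₂ < m₁ →
      waldspurger ((m₁ - m₂ - 1) / 2, ((m₁ : ℤ) + (m₂ : ℤ) + 1) / 2) = (m₁, m₂) := by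
    intro h h'
    apply key <;> omega
  have C : m₁ % 2 ≠ m₂ % 2 → m₁ < m₂ →
      waldspurger ((m₂ - m₁ - 1) / 2, -(((m₁ : ℤ) + (m₂ : ℤ) + 1) / 2)) = (m₁, m₂) := by
    intro h h'
    apply key <;> omega
  refine ⟨?_, A, B, C⟩
  by_cases h : m₁ % 2 = m₂ % 2
  · exact ⟨_, A h⟩
  · rcases lt_trichotomy m₁ m₂ with h' | h' | h'
    · exact ⟨_, C h h'⟩
    · exact absurd (by rw [h']) h
    · exact ⟨_, B h h'⟩
end

section
/- For every natural number n, the set {(h₁,h₂) ∈ ℕ × ℤ : h₁(h₁+1) + h₂² = n} and the set {(m₁,m₂) ∈ ℕ × ℕ : m₁(m₁+1)/2 + m₂(m₂+1)/2 = n} are finite and have the same cardinality. -/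
/-- The forward map `(h, k) ↦ (m₁, m₂)`, with `2m₁+1 = |2h+1+2k|`, `2m₂+1 = |2h+1-2k|`. -/
def fwdMap (p : ℕ × ℤ) : ℕ × ℕ :=
  (if 0 ≤ (p.1 : ℤ) + p.2 then ((p.1 : ℤ) + p.2).toNat else (-((p.1 : ℤ) + p.2) - 1).toNat,
   if 0 ≤ (p.1 : ℤ) - p.2 then ((p.1 : ℤ) - p.2).toNat else (-((p.1 : ℤ) - p.2) - 1).toNat)

theorem fwdMap_injective : Function.Injective fwdMap := by
  rintro ⟨a, b⟩ ⟨c, d⟩ h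
  simp only [fwdMap, Prod.mk.injEq] at h ⊢
  obtain ⟨h1, h2⟩ := h
  split_ifs at h1 h2 <;> omega

theorem fwdMap_surjective : Function.Surjective fwdMap := by
  rintro ⟨m, l⟩
  by_cases hp : (m + l) % 2 = 0
  · refine ⟨((m + l) / 2, ((m : ℤ) - l) / 2), ?_⟩
    simp only [fwdMap, Prod.mk.injEq]
    constructor <;> split_ifs <;> omega
  · by_cases hlt : l < m
    · refine ⟨((m - l - 1) / 2, (((m : ℤ) + l + 1) / 2)), ?_⟩
      simp only [fwdMap, Prod.mk.injEq]
      constructor <;> split_ifs <;> omega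
    · refine ⟨((l - m - 1) / 2, -(((m : ℤ) + l + 1) / 2)), ?_⟩
      simp only [fwdMap, Prod.mk.injEq]
      constructor <;> split_ifs <;> omega

theorem fold_mul (z : ℤ) :
    (((if 0 ≤ z then z.toNat else (-z - 1).toNat : ℕ) : ℤ)) *
      (((if 0 ≤ z then z.toNat else (-z - 1).toNat : ℕ) : ℤ) + 1) = z * (z + 1) := by
  split_ifs with h
  · rw [Int.toNat_of_nonneg h]
  · rw [Int.toNat_of_nonneg (by omega)]; ring

theorem fwdMap_mem (n : ℕ) (p : ℕ × ℤ) :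
    (fwdMap p).1 * ((fwdMap p).1 + 1) + (fwdMap p).2 * ((fwdMap p).2 + 1) = 2 * n ↔
      (p.1 : ℤ) * (p.1 + 1) + p.2 ^ 2 = (n : ℤ) := by
  have h1 := fold_mul ((p.1 : ℤ) + p.2)
  have h2 := fold_mul ((p.1 : ℤ) - p.2)
  rw [← Nat.cast_inj (R := ℤ)]
  simp only [Nat.cast_add, Nat.cast_mul, Nat.cast_one, Nat.cast_ofNat]
  simp only [fwdMap]
  rw [h1, h2]
  constructor <;> intro h <;> linarith

/-- For every `n`, the sets `{(h₁,h₂) ∈ ℕ × ℤ : h₁(h₁+1) + h₂² = n}` and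
`{(m₁,m₂) ∈ ℕ × ℕ : m₁(m₁+1)/2 + m₂(m₂+1)/2 = n}` (the latter written as
`m₁(m₁+1) + m₂(m₂+1) = 2n`) are finite and have the same cardinality. -/
theorem card_quadratic_sets_eq (n : ℕ) :
    {p : ℕ × ℤ | (p.1 : ℤ) * (p.1 + 1) + p.2 ^ 2 = (n : ℤ)}.Finite ∧
    {q : ℕ × ℕ | q.1 * (q.1 + 1) + q.2 * (q.2 + 1) = 2 * n}.Finite ∧
    {p : ℕ × ℤ | (p.1 : ℤ) * (p.1 + 1) + p.2 ^ 2 = (n : ℤ)}.ncard =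
      {q : ℕ × ℕ | q.1 * (q.1 + 1) + q.2 * (q.2 + 1) = 2 * n}.ncard := by
  have hfin : {q : ℕ × ℕ | q.1 * (q.1 + 1) + q.2 * (q.2 + 1) = 2 * n}.Finite := by
    apply (Set.finite_Iic ((2 * n, 2 * n) : ℕ × ℕ)).subset
    rintro ⟨a, b⟩ h
    simp only [Set.mem_setOf_eq] at h
    simp only [Set.mem_Iic, Prod.mk_le_mk]
    constructor <;> nlinarith [Nat.zero_le (a * a), Nat.zero_le (b * b)]
  have himg : fwdMap '' {p : ℕ × ℤ | (p.1 : ℤ) * (p.1 + 1) + p.2 ^ 2 = (n : ℤ)} =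
      {q : ℕ × ℕ | q.1 * (q.1 + 1) + q.2 * (q.2 + 1) = 2 * n} := by
    ext q
    obtain ⟨p, rfl⟩ := fwdMap_surjective q
    rw [fwdMap_injective.mem_set_image]
    exact (fwdMap_mem n p).symm
  refine ⟨?_, hfin, ?_⟩
  · rw [← himg] at hfin
    exact hfin.of_finite_image fwdMap_injective.injOn
  · rw [← himg, Set.ncard_image_of_injective _ fwdMap_injective]
end

section
/- For every natural number n, the number of partitions of n equals the number of triples (m, π₁, π₂) where m is a natural number, π₁ and π₂ are partitions (of any natural numbers), and m(m+1)/2 + 2|π₁| + 2|π₂| = n. -/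
/-- The type of all partitions (of any natural number): a partition together
with the natural number it partitions. -/
def AnyPartition : Type := Σ k : ℕ, Nat.Partition k

/-- The size `|π|` (sum of the parts) of a partition of any natural number. -/
def AnyPartition.size (π : AnyPartition) : ℕ := π.1

theorem AnyPartition.ext_parts {π ρ : AnyPartition} (h : π.2.parts = ρ.2.parts) : π = ρ := by
  obtain ⟨k, p⟩ := π
  obtain ⟨l, q⟩ := ρ
  have hkl : k = l := by
    rw [← p.parts_sum, ← q.parts_sum]
    exact congrArg _ h
  subst hkl
  have : p = q := Nat.Partition.ext h
  rw [this]

/-- The gaps of the increasing enumeration of a finite set. -/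
def gapFun (S : Finset ℕ) {N : ℕ} (h : S.card = N) (i : Fin N) : ℕ :=
  S.orderEmbOfFin h i - i

theorem le_of_strictMono_fin {N : ℕ} {f : Fin N → ℕ} (hf : StrictMono f) (i : Fin N) :
    (i : ℕ) ≤ f i := by
  obtain ⟨i, hi⟩ := i
  induction i with
  | zero => simp
  | succ k ih =>
    have h1 := ih (by omega)
    have h2 : f ⟨k, by omega⟩ < f ⟨k + 1, hi⟩ := hf (by simp [Fin.lt_def])
    simp only at h1 ⊢
    omega

theorem gapFun_add (S : Finset ℕ) {N : ℕ} (h : S.card = N) (i : Fin N) :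
    gapFun S h i + i = S.orderEmbOfFin h i := by
  have := le_of_strictMono_fin (S.orderEmbOfFin h).strictMono i
  unfold gapFun
  omega

theorem gapFun_mono (S : Finset ℕ) {N : ℕ} (h : S.card = N) : Monotone (gapFun S h) := by
  have key : ∀ d : ℕ, ∀ i j : Fin N, (j : ℕ) = i + d → gapFun S h i ≤ gapFun S h j := by
    intro d
    induction d with
    | zero => intro i j hij; have : i = j := Fin.ext (by omega); rw [this]
    | succ d ih =>
      intro i j hij
      have h1 := ih i ⟨i + d, by omega⟩ rfl
      have h2 : S.orderEmbOfFin h ⟨i + d, by omega⟩ < S.orderEmbOfFin h j :=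
        (S.orderEmbOfFin h).strictMono (by rw [Fin.lt_def]; simp only; omega)
      rw [← gapFun_add, ← gapFun_add] at h2
      simp only at h2
      omega
  intro i j hij
  exact key (j - i) i j (by have := Fin.le_def.1 hij; omega)

/-- The multiset of gaps. -/
def gapMul (S : Finset ℕ) : Multiset ℕ := (List.ofFn (gapFun S rfl) : Multiset ℕ)

theorem gapMul_eq (S : Finset ℕ) {N : ℕ} (h : S.card = N) :
    gapMul S = (List.ofFn (gapFun S h) : Multiset ℕ) := by
  subst h; rfl

theorem gapMul_card (S : Finset ℕ) : (gapMul S).card = S.card := by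
  simp [gapMul]

theorem sum_orderEmb (S : Finset ℕ) {N : ℕ} (h : S.card = N) :
    ∑ i, S.orderEmbOfFin h i = ∑ x ∈ S, x := by
  conv_rhs => rw [← Finset.image_orderEmbOfFin_univ S h]
  rw [Finset.sum_image]
  intro a _ b _ hab
  exact (S.orderEmbOfFin h).injective hab

theorem gapMul_sum (S : Finset ℕ) :
    2 * (gapMul S).sum + S.card * (S.card - 1) = 2 * ∑ x ∈ S, x := by
  rw [← sum_orderEmb S rfl, gapMul, Multiset.sum_coe, List.sum_ofFn]
  have h2 : ∑ i : Fin S.card, (i : ℕ) = ∑ i ∈ Finset.range S.card, i :=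
    Fin.sum_univ_eq_sum_range (fun i => i) S.card
  have h3 := Finset.sum_range_id_mul_two S.card
  have h4 : ∑ i, S.orderEmbOfFin rfl i = ∑ i, gapFun S rfl i + ∑ i : Fin S.card, (i : ℕ) := by
    rw [← Finset.sum_add_distrib]
    exact Finset.sum_congr rfl fun i _ => (gapFun_add S rfl i).symm
  omega

theorem gapMul_inj {S T : Finset ℕ} (hc : S.card = T.card) (h : gapMul S = gapMul T) : S = T := by
  rw [gapMul_eq S hc, gapMul, Multiset.coe_eq_coe] at h
  have h1 := List.ofFn_injective (List.Perm.eq_of_sortedLE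
    (gapFun_mono S hc).sortedLE_ofFn (gapFun_mono T rfl).sortedLE_ofFn h)
  refine (Finset.image_orderEmbOfFin_univ S hc).symm.trans
    (Eq.trans ?_ (Finset.image_orderEmbOfFin_univ T rfl))
  refine Finset.image_congr fun i _ => ?_
  rw [← gapFun_add, ← gapFun_add, h1]

theorem gapMul_surj (m : Multiset ℕ) : ∃ S : Finset ℕ, S.card = m.card ∧ gapMul S = m := by
  set l := m.sort (· ≤ ·) with hl
  have hlen : l.length = m.card := Multiset.length_sort _
  have hmono : Monotone l.get := (Multiset.pairwise_sort m (· ≤ ·)).sortedLE.monotone_get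
  let f : Fin l.length → ℕ := fun i => l.get i + i
  have hf : StrictMono f := fun i j hij => by
    have := hmono hij.le
    have := Fin.lt_def.1 hij
    simp only [f]; omega
  have hcard : (Finset.univ.image f).card = l.length := by
    rw [Finset.card_image_of_injective _ hf.injective]; simp
  refine ⟨Finset.univ.image f, hcard.trans hlen, ?_⟩
  rw [gapMul_eq _ hcard]
  have : f = (Finset.univ.image f).orderEmbOfFin hcard :=
    Finset.orderEmbOfFin_unique hcard (fun x => by simp) hf
  have h2 : gapFun (Finset.univ.image f) hcard = l.get := by
    funext i
    unfold gapFun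
    rw [← congrFun this i]
    simp [f]
  rw [h2, List.ofFn_get, hl, Multiset.sort_eq]

/-- The partition encoded by a finite set of beta numbers. -/
def betaPart (S : Finset ℕ) : AnyPartition := ⟨_, Nat.Partition.ofMultiset (gapMul S)⟩

theorem betaPart_size (S : Finset ℕ) :
    2 * (betaPart S).size + S.card * (S.card - 1) = 2 * ∑ x ∈ S, x := gapMul_sum S

theorem eq_of_filter_ne_zero {s t : Multiset ℕ} (hc : s.card = t.card)
    (h : s.filter (· ≠ 0) = t.filter (· ≠ 0)) : s = t := by
  have e : ∀ u : Multiset ℕ,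
      u = Multiset.replicate (u.card - (u.filter (· ≠ 0)).card) 0 + u.filter (· ≠ 0) := by
    intro u
    have h1 := Multiset.filter_add_not (· = 0) u
    have h3 := congrArg Multiset.card h1
    rw [Multiset.card_add] at h3
    have h2 : u.filter (· = 0) = Multiset.replicate (u.card - (u.filter (· ≠ 0)).card) 0 := by
      rw [Multiset.eq_replicate]
      refine ⟨?_, fun b hb => (Multiset.mem_filter.1 hb).2⟩
      simp only [ne_eq]
      omega
    rw [← h2]
    exact h1.symm
  rw [e s, e t, hc, h]

theorem betaPart_inj {S T : Finset ℕ} (hc : S.card = T.card) (h : betaPart S = betaPart T) :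
    S = T := by
  apply gapMul_inj hc
  apply eq_of_filter_ne_zero (by rw [gapMul_card, gapMul_card, hc])
  have : (betaPart S).2.parts = (betaPart T).2.parts := by rw [h]
  simpa [betaPart] using this

theorem betaPart_surj (π : AnyPartition) {N : ℕ} (h : π.size ≤ N) :
    ∃ S : Finset ℕ, S.card = N ∧ betaPart S = π := by
  have hc : π.2.parts.card ≤ π.size := by
    have h1 : π.2.parts.sum = π.size := π.2.parts_sum
    rw [← h1]
    have := Multiset.card_nsmul_le_sum (s := π.2.parts) (a := 1) (fun x hx => π.2.parts_pos hx)
    simpa using this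
  obtain ⟨S, hS, hS2⟩ := gapMul_surj (Multiset.replicate (N - π.2.parts.card) 0 + π.2.parts)
  refine ⟨S, ?_, ?_⟩
  · rw [hS]; simp; omega
  · apply AnyPartition.ext_parts
    have h0 : π.2.parts.filter (· ≠ 0) = π.2.parts :=
      Multiset.filter_eq_self.2 fun x hx => (π.2.parts_pos hx).ne'
    have h1 : (Multiset.replicate (N - π.2.parts.card) 0).filter (fun x : ℕ => x ≠ 0) = 0 :=
      Multiset.filter_eq_nil.2 fun x hx => by simp [Multiset.eq_of_mem_replicate hx]
    change (gapMul S).filter (· ≠ 0) = _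
    rw [hS2, Multiset.filter_add, h0, h1, zero_add]

/-- Halves of the even elements. -/
def evs (S : Finset ℕ) : Finset ℕ := (S.filter (fun x => x % 2 = 0)).image (· / 2)

/-- Halves of the odd elements. -/
def ods (S : Finset ℕ) : Finset ℕ := (S.filter (fun x => x % 2 = 1)).image (· / 2)

theorem mem_evs {S : Finset ℕ} {x : ℕ} : x ∈ evs S ↔ 2 * x ∈ S := by
  simp only [evs, Finset.mem_image, Finset.mem_filter]
  constructor
  · rintro ⟨a, ⟨h1, h2⟩, rfl⟩
    rwa [show 2 * (a / 2) = a by omega]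
  · intro h
    exact ⟨2 * x, ⟨h, by omega⟩, by omega⟩

theorem mem_ods {S : Finset ℕ} {x : ℕ} : x ∈ ods S ↔ 2 * x + 1 ∈ S := by
  simp only [ods, Finset.mem_image, Finset.mem_filter]
  constructor
  · rintro ⟨a, ⟨h1, h2⟩, rfl⟩
    rwa [show 2 * (a / 2) + 1 = a by omega]
  · intro h
    exact ⟨2 * x + 1, ⟨h, by omega⟩, by omega⟩

/-- Interleaving. -/
def glue (A B : Finset ℕ) : Finset ℕ := A.image (2 * ·) ∪ B.image (2 * · + 1)

theorem evs_glue (A B : Finset ℕ) : evs (glue A B) = A := by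
  ext x
  simp only [mem_evs, glue, Finset.mem_union, Finset.mem_image]
  constructor
  · rintro (⟨a, ha, h⟩ | ⟨a, ha, h⟩)
    · rwa [show x = a by omega]
    · omega
  · intro h; exact Or.inl ⟨x, h, rfl⟩

theorem ods_glue (A B : Finset ℕ) : ods (glue A B) = B := by
  ext x
  simp only [mem_ods, glue, Finset.mem_union, Finset.mem_image]
  constructor
  · rintro (⟨a, ha, h⟩ | ⟨a, ha, h⟩)
    · omega
    · rwa [show x = a by omega]
  · intro h; exact Or.inr ⟨x, h, rfl⟩

theorem glue_evs_ods (S : Finset ℕ) : glue (evs S) (ods S) = S := by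
  ext x
  simp only [glue, Finset.mem_union, Finset.mem_image, mem_evs, mem_ods]
  constructor
  · rintro (⟨a, ha, rfl⟩ | ⟨a, ha, rfl⟩) <;> exact ha
  · intro h
    rcases Nat.mod_two_eq_zero_or_one x with hx | hx
    · have : 2 * (x / 2) = x := by omega
      exact Or.inl ⟨x / 2, by rwa [this], this⟩
    · have : 2 * (x / 2) + 1 = x := by omega
      exact Or.inr ⟨x / 2, by rwa [this], this⟩

theorem glue_disj (A B : Finset ℕ) : Disjoint (A.image (2 * ·)) (B.image (2 * · + 1)) := by
  rw [Finset.disjoint_left]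
  intro x hx hy
  simp only [Finset.mem_image] at hx hy
  obtain ⟨a, _, ha⟩ := hx
  obtain ⟨b, _, hb⟩ := hy
  omega

theorem glue_card (A B : Finset ℕ) : (glue A B).card = A.card + B.card := by
  rw [glue, Finset.card_union_of_disjoint (glue_disj A B),
    Finset.card_image_of_injective _ (fun a b h => by grind),
    Finset.card_image_of_injective _ (fun a b h => by grind)]

theorem glue_sum (A B : Finset ℕ) :
    ∑ x ∈ glue A B, x = 2 * ∑ x ∈ A, x + (2 * ∑ x ∈ B, x + B.card) := by
  rw [glue, Finset.sum_union (glue_disj A B),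
    Finset.sum_image (fun a _ b _ h => by grind),
    Finset.sum_image (fun a _ b _ h => by grind),
    Finset.sum_add_distrib, Finset.mul_sum, Finset.mul_sum]
  simp

/-- The index of the 2-core in terms of the number of even beta numbers. -/
def coreIdx (M a : ℕ) : ℕ := if a ≤ M then 2 * (M - a) else 2 * (a - M) - 1

theorem coreIdx_inj {M a b : ℕ} (h : coreIdx M a = coreIdx M b) : a = b := by
  unfold coreIdx at h
  split_ifs at h <;> omega

theorem mul_pred_cast (a : ℕ) : ((a * (a - 1) : ℕ) : ℤ) = a * (a - 1) := by
  cases a <;> simp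

theorem coreIdx_tri {M a b : ℕ} (h : a + b = 2 * M) :
    a * (a - 1) + b * (b - 1) + b =
      M * (2 * M - 1) + coreIdx M a * (coreIdx M a + 1) / 2 := by
  have key : ∃ t : ℕ, coreIdx M a * (coreIdx M a + 1) = 2 * t ∧
      a * (a - 1) + b * (b - 1) + b = M * (2 * M - 1) + t := by
    have hM : ((M * (2 * M - 1) : ℕ) : ℤ) = M * (2 * M - 1) := by
      rcases M with _ | M
      · simp
      · rw [show 2 * (M + 1) - 1 = 2 * M + 1 by omega]; push_cast; ring
    unfold coreIdx
    split_ifs with hle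
    · obtain ⟨d, rfl⟩ := Nat.exists_eq_add_of_le hle
      obtain rfl : b = a + 2 * d := by omega
      refine ⟨d * (2 * d + 1), ?_, ?_⟩
      · rw [show a + d - a = d by omega]; ring
      · zify [mul_pred_cast, hM]
        ring
    · obtain ⟨d, rfl⟩ : ∃ d, a = M + (d + 1) := ⟨a - M - 1, by omega⟩
      obtain ⟨c, rfl⟩ : ∃ c, M = c + (d + 1) := ⟨M - (d + 1), by omega⟩
      obtain rfl : b = c := by omega
      refine ⟨(2 * d + 1) * (d + 1), ?_, ?_⟩
      · rw [show 2 * (b + (d + 1) + (d + 1) - (b + (d + 1))) - 1 = 2 * d + 1 by omega]; ring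
      · zify [mul_pred_cast, hM]
        ring
  obtain ⟨t, h1, h2⟩ := key
  rw [h1, h2]
  simp

theorem coreIdx_surj (M m : ℕ) (h : m ≤ 2 * M) : ∃ a, a ≤ 2 * M ∧ coreIdx M a = m := by
  unfold coreIdx
  rcases Nat.mod_two_eq_zero_or_one m with hm | hm
  · exact ⟨M - m / 2, by omega, by rw [if_pos (by omega)]; omega⟩
  · exact ⟨M + (m + 1) / 2, by omega, by rw [if_neg (by omega)]; omega⟩

/-- Beta sets with `2M` elements of partitions of `n`. -/
def BetaSet (M n : ℕ) : Type :=
  {S : Finset ℕ // S.card = 2 * M ∧ ∑ x ∈ S, x = n + M * (2 * M - 1)}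

theorem quot_size {M : ℕ} (A B : Finset ℕ) (h : A.card + B.card = 2 * M) :
    ∑ x ∈ glue A B, x = coreIdx M A.card * (coreIdx M A.card + 1) / 2
      + 2 * (betaPart A).size + 2 * (betaPart B).size + M * (2 * M - 1) := by
  rw [glue_sum]
  have h1 := betaPart_size A
  have h2 := betaPart_size B
  have h3 := coreIdx_tri h
  omega

theorem card_betaSet_eq_partition (n : ℕ) :
    Nat.card (BetaSet n n) = Nat.card (Nat.Partition n) := by
  symm
  have hb : ∀ S : BetaSet n n, (betaPart S.1).size = n := fun S => by
    have h1 := betaPart_size S.1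
    rw [S.2.1, S.2.2, mul_assoc] at h1
    omega
  have e1 : Nat.card (Nat.Partition n) = Nat.card {π : AnyPartition // π.size = n} := by
    apply Nat.card_congr
    refine Equiv.ofBijective (fun p => ⟨⟨n, p⟩, rfl⟩) ⟨?_, ?_⟩
    · intro p q h
      have h' := congrArg (fun x => x.1.2.parts) h
      exact Nat.Partition.ext h'
    · rintro ⟨⟨k, p⟩, h⟩
      change k = n at h
      subst h
      exact ⟨p, rfl⟩
  rw [e1]
  symm
  apply Nat.card_congr
  refine Equiv.ofBijective (fun S => ⟨betaPart S.1, hb S⟩) ⟨?_, ?_⟩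
  · intro S T h
    exact Subtype.ext (betaPart_inj (S.2.1.trans T.2.1.symm) (congrArg Subtype.val h))
  · rintro ⟨π, hπ⟩
    obtain ⟨S, hS, rfl⟩ := betaPart_surj π (N := 2 * n) (by omega)
    refine ⟨⟨S, hS, ?_⟩, rfl⟩
    have h1 := betaPart_size S
    rw [hS, hπ, mul_assoc] at h1
    omega

theorem card_betaSet_eq_triples (n : ℕ) :
    Nat.card (BetaSet n n) = Nat.card {t : ℕ × AnyPartition × AnyPartition //
        t.1 * (t.1 + 1) / 2 + 2 * t.2.1.size + 2 * t.2.2.size = n} := by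
  have hs : ∀ S : BetaSet n n, (evs S.1).card + (ods S.1).card = 2 * n := fun S => by
    rw [← glue_card, glue_evs_ods, S.2.1]
  apply Nat.card_congr
  refine Equiv.ofBijective (fun S => ⟨(coreIdx n (evs S.1).card, betaPart (evs S.1),
    betaPart (ods S.1)), ?_⟩) ⟨?_, ?_⟩
  · have := quot_size _ _ (hs S)
    rw [glue_evs_ods, S.2.2] at this
    simp only
    omega
  · intro S T h
    have h' := congrArg Subtype.val h
    simp only [Prod.mk.injEq] at h'
    obtain ⟨h1, h2, h3⟩ := h'
    have hS := hs S
    have hT := hs T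
    have hc := coreIdx_inj h1
    have he := betaPart_inj hc h2
    have ho := betaPart_inj (by omega) h3
    apply Subtype.ext
    rw [← glue_evs_ods S.1, ← glue_evs_ods T.1, he, ho]
  · rintro ⟨⟨m, π, ρ⟩, ht⟩
    simp only at ht
    have hm : m ≤ m * (m + 1) / 2 := by
      rw [Nat.le_div_iff_mul_le (by norm_num)]
      rcases m with _ | m
      · simp
      · exact Nat.mul_le_mul_left _ (by omega)
    obtain ⟨a, ha, hm2⟩ := coreIdx_surj n m (by omega)
    have hab : π.size ≤ a ∧ ρ.size ≤ 2 * n - a := by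
      unfold coreIdx at hm2
      split_ifs at hm2 <;> omega
    obtain ⟨A, hA, rfl⟩ := betaPart_surj π hab.1
    obtain ⟨B, hB, rfl⟩ := betaPart_surj ρ hab.2
    have hsum : A.card + B.card = 2 * n := by omega
    have hq := quot_size A B hsum
    refine ⟨⟨glue A B, by rw [glue_card, hsum], ?_⟩, ?_⟩
    · rw [hq, hA, hm2, ht]
    · apply Subtype.ext
      simp only [evs_glue, ods_glue, hA, hm2]

/-- For every natural number `n`, the number of partitions of `n` equals the
number of triples `(m, π₁, π₂)` where `m ∈ ℕ`, `π₁, π₂` are partitions of any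
natural numbers, and `m(m+1)/2 + 2|π₁| + 2|π₂| = n`. -/
theorem card_partitions_eq_card_triples (n : ℕ) :
    Nat.card (Nat.Partition n) =
      Nat.card {t : ℕ × AnyPartition × AnyPartition //
        t.1 * (t.1 + 1) / 2 + 2 * t.2.1.size + 2 * t.2.2.size = n} := by
  rw [← card_betaSet_eq_partition, card_betaSet_eq_triples]
end

section
/- For every natural number n, the number of pairs of partitions (μ₁, μ₂) with |μ₁| + |μ₂| = n equals the number of 6-tuples (m₁, m₂, π₁, π₂, π₃, π₄) where m₁, m₂ are natural numbers, π₁, π₂, π₃, π₄ are partitions (of any natural numbers), and m₁(m₁+1)/2 + m₂(m₂+1)/2 + 2(|π₁| + |π₂| + |π₃| + |π₄|) = n. -/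
namespace TwoQuot

/-- Partitions as multisets without zero. -/
abbrev Q : Type := {s : Multiset ℕ // 0 ∉ s}

lemma mono_inj {N : ℕ} {f g : Fin N → ℕ} (hf : Monotone f) (hg : Monotone g)
    (h : Multiset.map f Finset.univ.val = Multiset.map g Finset.univ.val) : f = g := by
  have h1 : ∀ k : Fin N → ℕ, Multiset.map k Finset.univ.val = (List.ofFn k : Multiset ℕ) := by
    intro k
    rw [Fin.univ_val_map]
  rw [h1, h1, Multiset.coe_eq_coe] at h
  exact List.ofFn_injective
    (h.eq_of_sortedLE (List.sortedLE_ofFn_iff.2 hf) (List.sortedLE_ofFn_iff.2 hg))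

lemma mono_surj {N : ℕ} (s : Multiset ℕ) (hs : s.card = N) :
    ∃ f : Fin N → ℕ, Monotone f ∧ Multiset.map f Finset.univ.val = s := by
  subst hs
  have hl : (s.sort (· ≤ ·)).length = s.card := Multiset.length_sort ..
  have hm : (s.sort (· ≤ ·)).SortedLE :=
    List.sortedLE_iff_pairwise.2 (Multiset.pairwise_sort s (· ≤ ·))
  have he := Multiset.sort_eq s (· ≤ ·)
  rw [← hl]
  refine ⟨(s.sort (· ≤ ·)).get, hm.monotone_get, ?_⟩
  rw [Fin.univ_val_map, List.ofFn_get, he]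

noncomputable def eM (N : ℕ) :
    {g : Fin N → ℕ // Monotone g} ≃ {s : Multiset ℕ // s.card = N} :=
  Equiv.ofBijective (fun g => ⟨Multiset.map g.1 Finset.univ.val, by simp⟩) (by
    constructor
    · intro f g h
      exact Subtype.ext (mono_inj f.2 g.2 (congrArg Subtype.val h))
    · rintro ⟨s, hs⟩
      obtain ⟨f, hf, h⟩ := mono_surj s hs
      exact ⟨⟨f, hf⟩, Subtype.ext h⟩)

noncomputable def eS (N : ℕ) :
    {g : Fin N → ℕ // StrictMono g} ≃ {s : Finset ℕ // s.card = N} :=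
  Equiv.ofBijective (fun g => ⟨Finset.univ.map ⟨g.1, g.2.injective⟩, by simp⟩) (by
    constructor
    · intro f g h
      exact Subtype.ext (mono_inj f.2.monotone g.2.monotone
        (congrArg (fun x => x.1.val) h))
    · rintro ⟨s, hs⟩
      obtain ⟨f, hf, h⟩ := mono_surj s.val hs
      have hi : Function.Injective f := by
        have := s.nodup
        rw [← h, Fin.univ_val_map, Multiset.coe_nodup, List.nodup_ofFn] at this
        exact this
      exact ⟨⟨f, hf.strictMono_of_injective hi⟩, Subtype.ext (Finset.val_injective h)⟩)

lemma strict_le {N : ℕ} {f : Fin N → ℕ} (hf : StrictMono f) :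
    ∀ (i j : Fin N), i ≤ j → f i + (j.1 - i.1) ≤ f j := by
  have : ∀ (d : ℕ) (i j : Fin N), j.1 = i.1 + d → f i + d ≤ f j := by
    intro d
    induction d with
    | zero => 
      intro i j h
      have : i = j := Fin.ext (by omega)
      subst this; simp
    | succ d ih =>
      intro i j h
      have h1 := ih i ⟨i.1 + d, by omega⟩ rfl
      have h2 : f ⟨i.1 + d, by omega⟩ < f j := hf (by rw [Fin.lt_def]; simp; omega)
      omega
  intro i j h
  exact this _ i j (by have := Fin.le_def.1 h; omega)

lemma strict_ge {N : ℕ} {f : Fin N → ℕ} (hf : StrictMono f) (i : Fin N) : i.1 ≤ f i := by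
  have := strict_le hf ⟨0, i.pos⟩ i (by rw [Fin.le_def]; simp)
  simp at this
  omega

def eSM (N : ℕ) : {g : Fin N → ℕ // StrictMono g} ≃ {g : Fin N → ℕ // Monotone g} where
  toFun g := ⟨fun i => g.1 i - i.1, by
    intro i j h
    have := strict_le g.2 i j h
    have := strict_ge g.2 i
    have := Fin.le_def.1 h
    simp only
    omega⟩
  invFun g := ⟨fun i => g.1 i + i.1, by
    intro i j h
    have := g.2 h.le
    have := Fin.lt_def.1 h
    simp only
    omega⟩
  left_inv g := by
    ext i
    have := strict_ge g.2 i
    simp only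
    omega
  right_inv g := by
    ext i
    simp

lemma sum_filter_ne (s : Multiset ℕ) : (s.filter (· ≠ 0)).sum = s.sum := by
  induction s using Multiset.induction_on with
  | empty => simp
  | cons a s ih =>
    by_cases h : a = 0 <;> simp_all

lemma filter_add_repl (s : Multiset ℕ) :
    s.filter (· ≠ 0) + Multiset.replicate (s.card - (s.filter (· ≠ 0)).card) 0 = s := by
  have h := Multiset.filter_add_not (· ≠ 0) s
  have h2 : s.filter (fun a => ¬ (a ≠ 0)) =
      Multiset.replicate (s.filter (fun a => ¬ (a ≠ 0))).card 0 := by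
    rw [Multiset.eq_replicate]
    refine ⟨rfl, ?_⟩
    intro b hb
    simpa using (Multiset.mem_filter.1 hb).2
  have h3 := congrArg Multiset.card h
  rw [Multiset.card_add] at h3
  have h4 : s.card - (s.filter (· ≠ 0)).card = (s.filter (fun a => ¬ (a ≠ 0))).card := by omega
  rw [h4, ← h2, h]

def eZ (N : ℕ) : {s : Multiset ℕ // s.card = N} ≃ {p : Q // p.1.card ≤ N} where
  toFun s := ⟨⟨s.1.filter (· ≠ 0), by simp⟩, by
    simpa [s.2] using Multiset.card_le_card (Multiset.filter_le (· ≠ 0) s.1)⟩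
  invFun p := ⟨p.1.1 + Multiset.replicate (N - p.1.1.card) 0, by
    have := p.2
    simp; omega⟩
  left_inv s := by
    obtain ⟨s, rfl⟩ := s
    exact Subtype.ext (filter_add_repl s)
  right_inv p := by
    obtain ⟨⟨p, h0⟩, hp⟩ := p
    apply Subtype.ext
    apply Subtype.ext
    simp only
    rw [Multiset.filter_add, Multiset.filter_eq_self.2, Multiset.filter_eq_nil.2]
    · simp
    · intro a ha
      simp [Multiset.eq_of_mem_replicate ha]
    · rintro a ha rfl
      exact h0 ha

noncomputable def beta (N : ℕ) : {X : Finset ℕ // X.card = N} ≃ {p : Q // p.1.card ≤ N} :=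
  (eS N).symm.trans ((eSM N).trans ((eM N).trans (eZ N)))

lemma beta_sum (N : ℕ) (X : {X : Finset ℕ // X.card = N}) :
    2 * ∑ x ∈ X.1, x + N = 2 * (beta N X).1.1.sum + N * N := by
  obtain ⟨f, rfl⟩ := (eS N).surjective X
  have h1 : (beta N (eS N f)).1.1.sum = ∑ i, (f.1 i - i.1) := by
    simp only [beta, Equiv.trans_apply, Equiv.symm_apply_apply]
    simp only [eZ, eM, eSM, Equiv.coe_fn_mk]
    rw [sum_filter_ne]
    rfl
  have h2 : ∑ x ∈ (eS N f).1, x = ∑ i, f.1 i := by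
    change ∑ x ∈ Finset.univ.map ⟨f.1, f.2.injective⟩, x = _
    rw [Finset.sum_map]
    rfl
  have h3 : ∑ i, f.1 i = ∑ i, (f.1 i - i.1) + ∑ i : Fin N, i.1 := by
    rw [← Finset.sum_add_distrib]
    refine Finset.sum_congr rfl fun i _ => ?_
    have := strict_ge f.2 i
    omega
  have h4 : (∑ i : Fin N, i.1) * 2 + N = N * N := by
    rw [Fin.sum_univ_eq_sum_range (fun i => i), Finset.sum_range_id_mul_two]
    cases N with
    | zero => rfl
    | succ n => simp; ring
  rw [h1, h2, h3]
  omega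

/-- partition of a beta set -/
noncomputable def C (X : Finset ℕ) : Q := (beta X.card ⟨X, rfl⟩).1

open Classical in
/-- beta set of size `N` of a partition -/
noncomputable def D (N : ℕ) (p : Q) : Finset ℕ :=
  if h : p.1.card ≤ N then ((beta N).symm ⟨p, h⟩).1 else ∅

lemma C_eq {N : ℕ} (X : {X : Finset ℕ // X.card = N}) : C X.1 = (beta N X).1 := by
  obtain ⟨X, rfl⟩ := X
  rfl

lemma card_D {N : ℕ} {p : Q} (h : p.1.card ≤ N) : (D N p).card = N := by
  rw [D, dif_pos h]
  exact ((beta N).symm ⟨p, h⟩).2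

lemma C_D {N : ℕ} {p : Q} (h : p.1.card ≤ N) : C (D N p) = p := by
  rw [D, dif_pos h, C_eq]
  simp

lemma D_C {N : ℕ} {X : Finset ℕ} (h : X.card = N) : D N (C X) = X := by
  subst h
  have : (C X).1.card ≤ X.card := (beta X.card ⟨X, rfl⟩).2
  rw [D, dif_pos this]
  simp [C]

lemma C_sum (X : Finset ℕ) :
    2 * ∑ x ∈ X, x + X.card = 2 * (C X).1.sum + X.card * X.card :=
  beta_sum X.card ⟨X, rfl⟩

lemma card_le_sum (p : Q) : p.1.card ≤ p.1.sum := by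
  have := Multiset.card_nsmul_le_sum (s := p.1) (a := 1) (by
    intro x hx
    have : x ≠ 0 := by rintro rfl; exact p.2 hx
    omega)
  simpa using this

/-- partitions of `n` versus beta sets of size `2n` -/
noncomputable def e1 (n : ℕ) : {p : Q // p.1.sum = n} ≃
    {X : Finset ℕ // X.card = 2 * n ∧ 2 * ∑ x ∈ X, x + 2 * n = 2 * n + 2 * n * (2 * n)} where
  toFun p := ⟨D (2 * n) p.1, by
    have h : p.1.1.card ≤ 2 * n := by
      have := card_le_sum p.1
      have := p.2
      omega
    have h1 := C_sum (D (2 * n) p.1)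
    rw [C_D h, card_D h, p.2] at h1
    exact ⟨card_D h, h1⟩⟩
  invFun X := ⟨C X.1, by
    have h1 := C_sum X.1
    have h2 := X.2.2
    rw [X.2.1] at h1
    omega⟩
  left_inv p := by
    have h : p.1.1.card ≤ 2 * n := by
      have := card_le_sum p.1
      have := p.2
      omega
    exact Subtype.ext (C_D h)
  right_inv X := Subtype.ext (D_C X.2.1)

/-- splitting into even and odd elements -/
def eo : Finset ℕ ≃ Finset ℕ × Finset ℕ :=
  (Equiv.natSumNatEquivNat.symm.finsetCongr).trans Finset.sumEquiv.toEquiv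

lemma eo_card (Y : Finset ℕ × Finset ℕ) : (eo.symm Y).card = Y.1.card + Y.2.card := by
  simp [eo]

lemma eo_sum (Y : Finset ℕ × Finset ℕ) :
    ∑ x ∈ eo.symm Y, x = 2 * ∑ x ∈ Y.1, x + 2 * ∑ x ∈ Y.2, x + Y.2.card := by
  simp [eo, Finset.sum_disjSum, Finset.sum_add_distrib, Finset.mul_sum]
  ring

noncomputable def e2 (n : ℕ) :
    {Y : Finset ℕ × Finset ℕ // Y.1.card + Y.2.card = 2 * n ∧
      2 * (2 * ∑ x ∈ Y.1, x + 2 * ∑ x ∈ Y.2, x + Y.2.card) + 2 * n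
        = 2 * n + 2 * n * (2 * n)} ≃ 
    {X : Finset ℕ // X.card = 2 * n ∧ 2 * ∑ x ∈ X, x + 2 * n = 2 * n + 2 * n * (2 * n)} :=
  eo.symm.subtypeEquiv (by intro Y; rw [eo_card, eo_sum])

lemma key {n : ℕ} {c : ℤ} {a b : ℕ} (h : 2 * c ^ 2 - c + 2 * (a + b : ℤ) = n) :
    (a : ℤ) ≤ n + c ∧ (b : ℤ) ≤ n - c := by
  constructor <;> nlinarith [sq_nonneg (c - 1), sq_nonneg c, sq_nonneg (c+1), Int.le_self_sq c, Int.le_self_sq (-c)]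

noncomputable def e3 (n : ℕ) :
    {Y : Finset ℕ × Finset ℕ // Y.1.card + Y.2.card = 2 * n ∧
      2 * (2 * ∑ x ∈ Y.1, x + 2 * ∑ x ∈ Y.2, x + Y.2.card) + 2 * n
        = 2 * n + 2 * n * (2 * n)} ≃ 
    {t : ℤ × Q × Q // 2 * t.1 ^ 2 - t.1 + 2 * (t.2.1.1.sum + t.2.2.1.sum : ℤ) = n} where
  toFun Y := ⟨((Y.1.1.card : ℤ) - n, C Y.1.1, C Y.1.2), by
    obtain ⟨⟨Y, Z⟩, h1, h2⟩ := Y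
    have h3 := C_sum Y
    have h4 := C_sum Z
    dsimp only at h1 h2 ⊢
    generalize (C Y).1.sum = u at *
    generalize (C Z).1.sum = v at *
    generalize ∑ x ∈ Y, x = s at *
    generalize ∑ x ∈ Z, x = t at *
    zify at h1 h2 h3 h4
    have h5 : (Z.card : ℤ) = 2 * n - Y.card := by linarith
    rw [h5] at h2 h4
    linarith⟩
  invFun t := ⟨(D (n + t.1.1).toNat t.1.2.1, D (n - t.1.1).toNat t.1.2.2), by
    obtain ⟨⟨c, p, q⟩, h⟩ := t
    dsimp only at h
    have hk := key h
    have hp := card_le_sum p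
    have hq := card_le_sum q
    simp only at *
    have hp' : p.1.card ≤ (n + c).toNat := by omega
    have hq' : q.1.card ≤ (n - c).toNat := by omega
    have h3 := C_sum (D (n + c).toNat p)
    have h4 := C_sum (D (n - c).toNat q)
    rw [C_D hp', card_D hp'] at h3
    rw [C_D hq', card_D hq'] at h4
    rw [card_D hp', card_D hq']
    refine ⟨by omega, ?_⟩
    have ea : ((n + c).toNat : ℤ) = n + c := by omega
    have eb : ((n - c).toNat : ℤ) = n - c := by omega
    generalize p.1.sum = u at *
    generalize q.1.sum = v at *
    generalize ∑ x ∈ D (n + c).toNat p, x = s at *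
    generalize ∑ x ∈ D (n - c).toNat q, x = t at *
    zify at h3 h4 ⊢
    rw [ea] at h3
    rw [eb] at h4
    rw [eb]
    linarith⟩
  left_inv Y := by
    obtain ⟨⟨Y, Z⟩, h1, h2⟩ := Y
    apply Subtype.ext
    dsimp only at h1 h2 ⊢
    rw [D_C (by omega), D_C (by omega)]
  right_inv t := by
    obtain ⟨⟨c, p, q⟩, h⟩ := t
    dsimp only at h
    have hk := key h
    have hp := card_le_sum p
    have hq := card_le_sum q
    apply Subtype.ext
    simp only at *
    have hp' : p.1.card ≤ (n + c).toNat := by omega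
    have hq' : q.1.card ≤ (n - c).toNat := by omega
    rw [C_D hp', C_D hq', card_D hp']
    have ea : ((n + c).toNat : ℤ) - n = c := by omega
    rw [ea]

def eZN : ℤ ≃ ℕ := (Equiv.neg ℤ).trans Equiv.intEquivNat

lemma eZN_tri (c : ℤ) : ((eZN c * (eZN c + 1) / 2 : ℕ) : ℤ) = 2 * c ^ 2 - c := by
  obtain ⟨c, rfl⟩ := (Equiv.neg ℤ).surjective c
  rcases c with m | m
  · have : eZN (Equiv.neg ℤ (Int.ofNat m)) = 2 * m := by
      rw [eZN, Equiv.trans_apply, Equiv.neg_apply, neg_neg]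
      rfl
    rw [this]
    have : 2 * m * (2 * m + 1) / 2 = m * (2 * m + 1) := by
      rw [mul_assoc]; simp
    rw [this]
    simp
    ring
  · have : eZN (Equiv.neg ℤ (Int.negSucc m)) = 2 * m + 1 := by
      rw [eZN, Equiv.trans_apply, Equiv.neg_apply, neg_neg]
      rfl
    rw [this]
    have : (2 * m + 1) * (2 * m + 1 + 1) / 2 = (2 * m + 1) * (m + 1) := by
      rw [show (2 * m + 1) * (2 * m + 1 + 1) = 2 * ((2 * m + 1) * (m + 1)) by ring]; simp
    rw [this]
    simp [Int.negSucc_eq]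
    ring

def eAP : AnyPartition ≃ Q where
  toFun p := ⟨p.2.parts, fun h => absurd (p.2.parts_pos h) (lt_irrefl 0)⟩
  invFun q := ⟨q.1.sum, ⟨q.1, fun {i} hi => Nat.pos_of_ne_zero (by rintro rfl; exact q.2 hi), rfl⟩⟩
  left_inv p := by
    obtain ⟨k, ⟨s, h, rfl⟩⟩ := p
    rfl
  right_inv q := rfl

lemma eAP_sum (p : AnyPartition) : (eAP p).1.sum = p.size := p.2.parts_sum

def sz (t : ℕ × AnyPartition × AnyPartition) : ℕ :=
  t.1 * (t.1 + 1) / 2 + 2 * (t.2.1.size + t.2.2.size)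

noncomputable def e4 (n : ℕ) :
    {p : AnyPartition // p.size = n} ≃ {t : ℕ × AnyPartition × AnyPartition // sz t = n} :=
  (eAP.subtypeEquiv (by intro p; rw [eAP_sum])).trans <|
  (e1 n).trans <| (e2 n).symm.trans <| (e3 n).trans <|
  ((Equiv.prodCongr eZN.symm (Equiv.prodCongr eAP eAP)).subtypeEquiv (by
    rintro ⟨m, p, q⟩
    obtain ⟨c, rfl⟩ := eZN.surjective m
    have := eZN_tri c
    simp only [sz, Equiv.prodCongr_apply, Prod.map, Equiv.symm_apply_apply, eAP_sum]
    rw [← this]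
    norm_cast)).symm

noncomputable def e5 : AnyPartition ≃ ℕ × AnyPartition × AnyPartition :=
  (Equiv.sigmaFiberEquiv AnyPartition.size).symm.trans <|
    (Equiv.sigmaCongrRight e4).trans (Equiv.sigmaFiberEquiv sz)

lemma e5_sz (p : AnyPartition) : sz (e5 p) = p.size :=
  (e4 p.size ⟨p, rfl⟩).2

def shuffle (A : Type) : (ℕ × A × A) × (ℕ × A × A) ≃ (ℕ × ℕ) × A × A × A × A where
  toFun x := ((x.1.1, x.2.1), x.1.2.1, x.1.2.2, x.2.2.1, x.2.2.2)
  invFun y := ((y.1.1, y.2.1, y.2.2.1), (y.1.2, y.2.2.2.1, y.2.2.2.2))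
  left_inv _ := rfl
  right_inv _ := rfl

end TwoQuot

/-- For every natural number `n`, the number of pairs of partitions `(μ₁, μ₂)`
with `|μ₁| + |μ₂| = n` equals the number of 6-tuples
`(m₁, m₂, π₁, π₂, π₃, π₄)` with `m₁, m₂ ∈ ℕ`, `π₁, …, π₄` partitions of any
natural numbers, and `m₁(m₁+1)/2 + m₂(m₂+1)/2 + 2(|π₁|+|π₂|+|π₃|+|π₄|) = n`. -/
theorem card_pairs_eq_card_sextuples (n : ℕ) :
    Nat.card {p : AnyPartition × AnyPartition // p.1.size + p.2.size = n} =
      Nat.card {t : (ℕ × ℕ) × AnyPartition × AnyPartition × AnyPartition × AnyPartition //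
        t.1.1 * (t.1.1 + 1) / 2 + t.1.2 * (t.1.2 + 1) / 2 +
          2 * (t.2.1.size + t.2.2.1.size + t.2.2.2.1.size + t.2.2.2.2.size) = n} := by
  refine Nat.card_congr
    (((Equiv.prodCongr TwoQuot.e5 TwoQuot.e5).trans (TwoQuot.shuffle _)).subtypeEquiv ?_)
  rintro ⟨p, q⟩
  have hp := TwoQuot.e5_sz p
  have hq := TwoQuot.e5_sz q
  simp only [TwoQuot.sz] at hp hq
  simp only [TwoQuot.shuffle, Equiv.trans_apply, Equiv.prodCongr_apply, Prod.map,
    Equiv.coe_fn_mk]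
  omega
end

section
/- The map Φ sending ((h₁,h₂), π₁, π₂, π₃, π₄) to (W(h₁,h₂), π₁, π₂, π₃, π₄) is a bijection from (ℕ × ℤ) × P⁴ to (ℕ × ℕ) × P⁴, where P is the set of all partitions. Moreover, for each such tuple, setting N₁ = |π₁| + |π₂|, N₂ = |π₃| + |π₄|, (m₁,m₂) = W(h₁,h₂), m = h₁(h₁+1) + h₂² + N₁ + N₂ and n = m₁(m₁+1)/2 + m₂(m₂+1)/2 + 2N₁ + 2N₂, one has n = m + N₁ + N₂. -/
/-- The map `Φ` sending `((h₁,h₂), π₁, π₂, π₃, π₄)` to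
`(W(h₁,h₂), π₁, π₂, π₃, π₄)`. -/
def Phi (x : (ℕ × ℤ) × AnyPartition × AnyPartition × AnyPartition × AnyPartition) :
    (ℕ × ℕ) × AnyPartition × AnyPartition × AnyPartition × AnyPartition :=
  (waldspurger x.1, x.2)

theorem waldspurger_bijective : Function.Bijective waldspurger := by
  constructor
  · rintro ⟨a, b⟩ ⟨c, d⟩ h
    simp only [waldspurger, Prod.mk.injEq] at h ⊢
    omega
  · rintro ⟨m, n⟩
    by_cases hp : (m + n) % 2 = 0
    · refine ⟨((m + n) / 2, ((m : ℤ) - n) / 2), ?_⟩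
      simp only [waldspurger, Prod.mk.injEq]
      omega
    · by_cases hl : n < m
      · refine ⟨((m - n - 1) / 2, ((m : ℤ) + n + 1) / 2), ?_⟩
        simp only [waldspurger, Prod.mk.injEq]
        omega
      · refine ⟨((n - m - 1) / 2, (-(m : ℤ) - n - 1) / 2), ?_⟩
        simp only [waldspurger, Prod.mk.injEq]
        omega

theorem triangle_toNat (a : ℤ) (k : ℕ) (hk : k = (max a (-a - 1)).toNat) :
    2 * ((k * (k + 1) / 2 : ℕ) : ℤ) = a * (a + 1) := by
  have h2 : 2 * (k * (k + 1) / 2) = k * (k + 1) :=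
    Nat.mul_div_cancel' (Nat.even_mul_succ_self k).two_dvd
  have h3 : 2 * ((k * (k + 1) / 2 : ℕ) : ℤ) = (k : ℤ) * (k + 1) := by exact_mod_cast h2
  rw [h3]
  have : (k : ℤ) = a ∨ (k : ℤ) = -a - 1 := by omega
  rcases this with h | h <;> rw [h]
  ring

/-- `Φ` is a bijection from `(ℕ × ℤ) × P⁴` to `(ℕ × ℕ) × P⁴`, where `P` is the
set of all partitions.  Moreover, for each tuple `((h₁,h₂), π₁, π₂, π₃, π₄)`,
setting `N₁ = |π₁| + |π₂|`, `N₂ = |π₃| + |π₄|`, `(m₁,m₂) = W(h₁,h₂)`,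
`m = h₁(h₁+1) + h₂² + N₁ + N₂` and
`n = m₁(m₁+1)/2 + m₂(m₂+1)/2 + 2N₁ + 2N₂`, one has `n = m + N₁ + N₂`. -/
theorem phi_bijective_and_rank :
    Function.Bijective Phi ∧
    ∀ (h₁ : ℕ) (h₂ : ℤ) (π₁ π₂ π₃ π₄ : AnyPartition),
      let N₁ : ℕ := π₁.size + π₂.size
      let N₂ : ℕ := π₃.size + π₄.size
      let m₁ : ℕ := (waldspurger (h₁, h₂)).1
      let m₂ : ℕ := (waldspurger (h₁, h₂)).2
      let m : ℤ := (h₁ : ℤ) * (h₁ + 1) + h₂ ^ 2 + N₁ + N₂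
      let n : ℕ := m₁ * (m₁ + 1) / 2 + m₂ * (m₂ + 1) / 2 + 2 * N₁ + 2 * N₂
      (n : ℤ) = m + N₁ + N₂ := by
  refine ⟨?_, ?_⟩
  · exact waldspurger_bijective.prodMap Function.bijective_id
  · intro h₁ h₂ π₁ π₂ π₃ π₄ N₁ N₂ m₁ m₂ m n
    have e1 := triangle_toNat ((h₁ : ℤ) + h₂) m₁
      (by simp only [m₁, waldspurger]; congr 2; ring)
    have e2 := triangle_toNat ((h₁ : ℤ) - h₂) m₂
      (by simp only [m₂, waldspurger]; congr 2; ring)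
    have e3 : (n : ℤ) = ((m₁ * (m₁ + 1) / 2 : ℕ) : ℤ) + ((m₂ * (m₂ + 1) / 2 : ℕ) : ℤ)
        + 2 * N₁ + 2 * N₂ := by
      simp only [n, Nat.cast_add, Nat.cast_mul, Nat.cast_ofNat]
    have e4 : m = (h₁ : ℤ) * (h₁ + 1) + h₂ ^ 2 + N₁ + N₂ := rfl
    rw [e3, e4]
    linarith
end

section
/- Let f ≥ 1 be a natural number, let S be a finite subset of ℕ, and suppose x ∈ S satisfies x ≥ 2f and x - 2f ∉ S. Let S' = (S \ {x}) ∪ {x - 2f}, so that S' is obtained from S by removing a 2f-hook. Then there is a sequence of finite subsets S = S₀, S₁, …, S_f = S' of ℕ such that for each k < f, S_{k+1} is obtained from S_k by removing a 2-hook. -/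
/-- `T` is obtained from `S` by removing an `a`-hook: there is `x ∈ S` with
`x ≥ a` and `x - a ∉ S` such that `T = (S \ {x}) ∪ {x - a}`. -/
def RemoveHook (a : ℕ) (S T : Finset ℕ) : Prop :=
  ∃ x ∈ S, a ≤ x ∧ x - a ∉ S ∧ T = insert (x - a) (S.erase x)

/-- Removing a `2f`-hook can be achieved by removing `f` `2`-hooks: if
`x ∈ S`, `x ≥ 2f`, `x - 2f ∉ S` and `S' = (S \ {x}) ∪ {x - 2f}`, then there is
a sequence `S = S₀, S₁, …, S_f = S'` in which each `S_{k+1}` is obtained from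
`S_k` by removing a `2`-hook. -/
theorem removeHook_two_f_eq_iterate_two (f : ℕ) (hf : 1 ≤ f) (S : Finset ℕ)
    (x : ℕ) (hx : x ∈ S) (hxf : 2 * f ≤ x) (hout : x - 2 * f ∉ S) :
    ∃ c : ℕ → Finset ℕ, c 0 = S ∧ c f = insert (x - 2 * f) (S.erase x) ∧
      ∀ k < f, RemoveHook 2 (c k) (c (k + 1)) := by
  induction f, hf using Nat.le_induction generalizing S x with
  | base =>
    refine ⟨fun k => if k = 0 then S else insert (x - 2 * 1) (S.erase x), by simp, by simp, ?_⟩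
    intro k hk
    obtain rfl : k = 0 := by omega
    exact ⟨x, hx, by omega, hout, by simp⟩
  | succ f hf ih =>
    have e : x - 2 * (f + 1) = x - 2 - 2 * f := by omega
    by_cases h : x - 2 ∈ S
    · obtain ⟨c, h0, h1, h2⟩ := ih S (x - 2) h (by omega) (by rwa [← e])
      refine ⟨fun k => if k ≤ f then c k else insert (x - 2 * (f + 1)) (S.erase x),
        by simpa using h0, by simp, ?_⟩
      intro k hk
      rcases Nat.lt_or_ge k f with hkf | hkf
      · have := h2 k hkf
        simpa [hkf.le, Nat.succ_le_of_lt hkf] using this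
      · obtain rfl : k = f := by omega
        have n1 : x ≠ x - 2 := by omega
        have n2 : x - 2 ≠ x - 2 - 2 * k := by omega
        have n3 : x ≠ x - 2 - 2 * k := by omega
        simp only [le_refl, if_true, h1, e]
        refine ⟨x, by simp [n1, hx], by omega, by simp [n2], ?_⟩
        rw [if_neg (by omega)]
        ext y
        simp only [Finset.mem_insert, Finset.mem_erase]
        grind
    · have n1 : x ≠ x - 2 := by omega
      have n2 : x - 2 - 2 * f ≠ x - 2 := by omega
      obtain ⟨c, h0, h1, h2⟩ := ih (insert (x - 2) (S.erase x)) (x - 2) (by simp) (by omega)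
        (by rw [e] at hout; simp [n2, hout])
      refine ⟨fun k => if k = 0 then S else c (k - 1), by simp, ?_, ?_⟩
      · simp only [Nat.add_eq_zero_iff, one_ne_zero, and_false, if_false, Nat.add_sub_cancel, h1, e]
        ext y
        simp only [Finset.mem_insert, Finset.mem_erase]
        grind
      · intro k hk
        rcases k with _ | k
        · exact ⟨x, hx, by omega, h, by simp [h0]⟩
        · simpa using h2 k (by omega)
end
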